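/- Let (X,d) be a compact metric space, f : X → X continuous with h_top(f) < +∞, and φ₁, φ₂, ψ ∈ C(X,ℝ) with ψ > 0. If t_{ψ,φ₁}(X,f) ∩ t_{ψ,φ₂}(X,f) ≠ ∅, then for every m ∈ t_{ψ,φ₁}(X,f) ∩ t_{ψ,φ₂}(X,f) and every p ∈ [0,1], P_ψ(pφ₁ + (1−p)φ₂) = P_ψ(φ₁) + (1−p)·(∫(φ₂ − φ₁) dm)/(∫ψ dm); moreover, for every p ∈ (0,1), t_{ψ, pφ₁+(1−p)φ₂}(X,f) ⊆ t_{ψ,φ₁}(X,f) ∩ t_{ψ,φ₂}(X,f). -/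

import Mathlib

open Filter Set Topology MeasureTheory ENNReal

variable {X : Type*}

/-- Birkhoff sum `S_n φ = ∑_{i<n} φ ∘ f^i`. -/
def birkhoff (f : X → X) (φ : X → ℝ) (n : ℕ) (x : X) : ℝ :=
  ∑ i ∈ Finset.range n, φ (f^[i] x)

section Metric
variable [MetricSpace X]

/-- `F` is an `(n,ε)`-spanning set of `Z`: every `y ∈ Z` is within Bowen distance
`d_n ≤ ε` of some point of `F`. -/
def IsSpanningSetOf (f : X → X) (n : ℕ) (ε : ℝ) (Z : Set X) (F : Finset X) : Prop :=
  ∀ y ∈ Z, ∃ x ∈ F, ∀ i < n, dist (f^[i] x) (f^[i] y) ≤ ε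

/-- `E` is an `(n,ε)`-separated set of `Z`: `E ⊆ Z` and distinct points of `E` are at
Bowen distance `d_n > ε`. -/
def IsSeparatedSetOf (f : X → X) (n : ℕ) (ε : ℝ) (Z : Set X) (E : Finset X) : Prop :=
  (E : Set X) ⊆ Z ∧ ∀ x ∈ E, ∀ y ∈ E, x ≠ y → ∃ i < n, ε < dist (f^[i] x) (f^[i] y)

/-- `S_T = {n : ℕ | ∃ x, S_nψ(x) ≤ T < S_{n+1}ψ(x)}`. -/
def inducedST (f : X → X) (ψ : X → ℝ) (T : ℝ) : Set ℕ :=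
  {n | ∃ x : X, birkhoff f ψ n x ≤ T ∧ T < birkhoff f ψ (n + 1) x}

/-- `X_n = {x | S_nψ(x) ≤ T < S_{n+1}ψ(x)}`. -/
def inducedXn (f : X → X) (ψ : X → ℝ) (T : ℝ) (n : ℕ) : Set X :=
  {x | birkhoff f ψ n x ≤ T ∧ T < birkhoff f ψ (n + 1) x}

/-- `Q_{ψ,T}(f,φ,ε)`: infimum over families of `(n,ε)`-spanning sets of the `X_n`, `n ∈ S_T`,
of `∑_{n ∈ S_T} ∑_{x ∈ F_n} e^{S_nφ(x)}`. -/
noncomputable def inducedQ (f : X → X) (ψ φ : X → ℝ) (T ε : ℝ) : ℝ≥0∞ :=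
  ⨅ (F : ℕ → Finset X) (_ : ∀ n ∈ inducedST f ψ T,
      IsSpanningSetOf f n ε (inducedXn f ψ T n) (F n)),
    ∑' n : inducedST f ψ T, ∑ x ∈ F n, ENNReal.ofReal (Real.exp (birkhoff f φ n x))

/-- `P_{ψ,T}(f,φ,ε)`: supremum over families of `(n,ε)`-separated sets of the `X_n`, `n ∈ S_T`,
of `∑_{n ∈ S_T} ∑_{x ∈ E_n} e^{S_nφ(x)}`. -/
noncomputable def inducedPsep (f : X → X) (ψ φ : X → ℝ) (T ε : ℝ) : ℝ≥0∞ :=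
  ⨆ (E : ℕ → Finset X) (_ : ∀ n ∈ inducedST f ψ T,
      IsSeparatedSetOf f n ε (inducedXn f ψ T n) (E n)),
    ∑' n : inducedST f ψ T, ∑ x ∈ E n, ENNReal.ofReal (Real.exp (birkhoff f φ n x))

/-- The ψ-induced topological pressure
`P_ψ(φ) = lim_{ε→0⁺} limsup_{T→∞} (1/T) log Q_{ψ,T}(f,φ,ε)`, the limit as `ε → 0⁺`
being realized as a `limsup` along `𝓝[>] 0` (since `ε ↦ limsup_T …` is monotone,
this coincides with the limit). -/
noncomputable def inducedPressure (f : X → X) (ψ φ : X → ℝ) : EReal :=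
  limsup (fun ε : ℝ =>
    limsup (fun T : ℝ => ENNReal.log (inducedQ f ψ φ T ε) * ((T⁻¹ : ℝ) : EReal)) atTop)
    (𝓝[>] (0 : ℝ))

/-- Topological entropy `h_top(f) = P_ψ(0)` with `ψ ≡ 1`. -/
noncomputable def topEntropy (f : X → X) : EReal :=
  inducedPressure f (fun _ => 1) (fun _ => 0)

end Metric
section Meas
variable [MetricSpace X] [MeasurableSpace X] [BorelSpace X]

/-- Entropy of the finite measurable partition of `X` induced by a map `q` into a finite
type: `H(q) = ∑_s -μ(q⁻¹{s}) log μ(q⁻¹{s})`. -/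
noncomputable def mapEntropy {S : Type*} [Fintype S] (μ : Measure X) (q : X → S) : ℝ :=
  ∑ s : S, Real.negMulLog ((μ (q ⁻¹' {s})).toReal)

/-- Kolmogorov–Sinai (measure-theoretic) entropy `h_μ(f)`: the supremum, over finite
measurable partitions (encoded as measurable maps `p : X → Fin k`), of
`lim_n (1/n) H(⋁_{i<n} f^{-i} p)`; the limit exists by subadditivity and is
realized here as a `liminf`. -/
noncomputable def measEntropy (f : X → X) (μ : Measure X) : EReal :=
  ⨆ (k : ℕ) (p : X → Fin k) (_ : Measurable p),
    liminf (fun n : ℕ =>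
      (((n : ℝ)⁻¹ * mapEntropy μ (fun x (i : Fin n) => p (f^[i] x)) : ℝ) : EReal)) atTop

/-- The set `M(X,f)` of `f`-invariant Borel probability measures on `X`. -/
def invMeasures (f : X → X) : Set (Measure X) :=
  {μ | IsProbabilityMeasure μ ∧ ∀ B : Set X, MeasurableSet B → μ (f ⁻¹' B) = μ B}

/-- `μ` is an equilibrium state of `P_ψ(φ)`:
`μ ∈ M(X,f)` and `P_ψ(φ) = (h_μ(f) + ∫φ dμ)/(∫ψ dμ)`. -/
noncomputable def equilibriumStates (f : X → X) (ψ φ : X → ℝ) : Set (Measure X) :=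
  {μ | μ ∈ invMeasures f ∧
    inducedPressure f ψ φ =
      (measEntropy f μ + ((∫ x, φ x ∂μ : ℝ) : EReal)) / (((∫ x, ψ x ∂μ : ℝ) : EReal))}

end Meas

section Tangent
variable [MetricSpace X] [MeasurableSpace X] [BorelSpace X]

/-- The set `t_{ψ,φ}(X,f)` of tangent functionals (subdifferentials) of `P_ψ(·)` at `φ`:
Borel probability measures `μ` with `P_ψ(φ+g) − P_ψ(φ) ≥ (∫g dμ)/(∫ψ dμ)` for all
continuous `g`. -/
noncomputable def tangentSet (f : X → X) (ψ φ : X → ℝ) : Set (ProbabilityMeasure X) :=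
  {μ | ∀ g : X → ℝ, Continuous g →
    (((∫ x, g x ∂(μ : Measure X)) / (∫ x, ψ x ∂(μ : Measure X)) : ℝ) : EReal) ≤
      inducedPressure f ψ (fun x => φ x + g x) - inducedPressure f ψ φ}

end Tangent

lemma ENNReal.tsum_rpow_mul_rpow_le {ι : Type*} (a b : ι → ℝ≥0∞) {p q : ℝ} (hp : 0 ≤ p)
    (hq : 0 ≤ q) (hpq : p + q = 1) :
    ∑' i, a i ^ p * b i ^ q ≤ (∑' i, a i) ^ p * (∑' i, b i) ^ q := by
  let _ : MeasurableSpace ι := ⊤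
  have h := ENNReal.lintegral_mul_norm_pow_le (μ := Measure.count) (f := a) (g := b)
    measurable_from_top.aemeasurable measurable_from_top.aemeasurable hp hq hpq
  rwa [lintegral_count' measurable_from_top, lintegral_count' measurable_from_top,
    lintegral_count' measurable_from_top] at h

lemma ENNReal.sum_rpow_mul_rpow_le {ι : Type*} (s : Finset ι) (a b : ι → ℝ≥0∞) {p q : ℝ}
    (hp : 0 ≤ p) (hq : 0 ≤ q) (hpq : p + q = 1) :
    ∑ i ∈ s, a i ^ p * b i ^ q ≤ (∑ i ∈ s, a i) ^ p * (∑ i ∈ s, b i) ^ q := by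
  have h := ENNReal.tsum_rpow_mul_rpow_le (fun i : s => a i) (fun i : s => b i) hp hq hpq
  rwa [Finset.tsum_subtype s a, Finset.tsum_subtype s b,
    Finset.tsum_subtype s fun i => a i ^ p * b i ^ q] at h

lemma ENNReal.ofReal_exp_rpow (x p : ℝ) :
    ENNReal.ofReal (Real.exp x) ^ p = ENNReal.ofReal (Real.exp (p * x)) := by
  rw [ENNReal.ofReal_rpow_of_pos (Real.exp_pos x), ← Real.exp_mul, mul_comm]

lemma ENNReal.ofReal_exp_mul (x y : ℝ) :
    ENNReal.ofReal (Real.exp x) * ENNReal.ofReal (Real.exp y) =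
      ENNReal.ofReal (Real.exp (x + y)) := by
  rw [← ENNReal.ofReal_mul (Real.exp_pos x).le, Real.exp_add]

lemma ENNReal.log_ofReal_exp (x : ℝ) : ENNReal.log (ENNReal.ofReal (Real.exp x)) = x := by
  rw [ENNReal.log_ofReal_of_pos (Real.exp_pos x), Real.log_exp]

lemma EReal.coe_mul_mul_inv_cancel (a : ℝ) {T : ℝ} (hT : 0 < T) :
    ((a * T : ℝ) : EReal) * ((T⁻¹ : ℝ) : EReal) = a := by
  rw [← EReal.coe_mul, mul_assoc, mul_inv_cancel₀ hT.ne', mul_one]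

section Birkhoff

lemma birkhoff_linearCombination (f : X → X) (φ₁ φ₂ : X → ℝ) (p q : ℝ) (n : ℕ) (x : X) :
    birkhoff f (fun x => p * φ₁ x + q * φ₂ x) n x =
      p * birkhoff f φ₁ n x + q * birkhoff f φ₂ n x := by
  simp [birkhoff, Finset.sum_add_distrib, Finset.mul_sum]

lemma mul_le_birkhoff (f : X → X) {ψ : X → ℝ} {c : ℝ} (hc : ∀ x, c ≤ ψ x) (n : ℕ) (x : X) :
    n * c ≤ birkhoff f ψ n x := by
  simpa [birkhoff] using
    Finset.card_nsmul_le_sum (Finset.range n) (fun i => ψ (f^[i] x)) c fun i _ => hc _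

lemma birkhoff_le_add_of_dist_le [MetricSpace X] (f : X → X) {φ : X → ℝ} {ε η : ℝ}
    (hφ : ∀ x y, dist x y ≤ ε → φ y ≤ φ x + η) {n : ℕ} {x y : X}
    (hxy : ∀ i < n, dist (f^[i] x) (f^[i] y) ≤ ε) :
    birkhoff f φ n y ≤ birkhoff f φ n x + n * η := by
  have h : birkhoff f φ n y ≤ ∑ i ∈ Finset.range n, (φ (f^[i] x) + η) :=
    Finset.sum_le_sum fun i hi => hφ _ _ (hxy i (Finset.mem_range.1 hi))
  simpa [birkhoff, Finset.sum_add_distrib] using h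

end Birkhoff

section Separated
variable [MetricSpace X] {f : X → X} {n : ℕ} {ε : ℝ} {Z : Set X} {E F : Finset X}

lemma IsSeparatedSetOf.exists_injOn (hE : IsSeparatedSetOf f n (2 * ε) Z E)
    (hF : IsSpanningSetOf f n ε Z F) :
    ∃ g : X → X, (∀ y ∈ E, g y ∈ F) ∧ InjOn g E ∧
      ∀ y ∈ E, ∀ i < n, dist (f^[i] (g y)) (f^[i] y) ≤ ε := by
  have h : ∀ y : X, ∃ x, y ∈ E → x ∈ F ∧ ∀ i < n, dist (f^[i] x) (f^[i] y) ≤ ε := by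
    intro y
    by_cases hy : y ∈ E
    · obtain ⟨x, hx, hxy⟩ := hF y (hE.1 hy)
      exact ⟨x, fun _ => ⟨hx, hxy⟩⟩
    · exact ⟨y, fun h => absurd h hy⟩
  choose g hg using h
  refine ⟨g, fun y hy => (hg y hy).1, fun y hy z hz hyz => ?_, fun y hy => (hg y hy).2⟩
  by_contra hne
  obtain ⟨i, hi, hlt⟩ := hE.2 y hy z hz hne
  have h₁ := (hg y hy).2 i hi
  have h₂ := (hg z hz).2 i hi
  rw [hyz] at h₁
  have h₃ := dist_triangle_left (f^[i] y) (f^[i] z) (f^[i] (g z))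
  linarith

lemma IsSpanningSetOf.exists_isSeparatedSetOf (hF : IsSpanningSetOf f n ε Z F) (hε : 0 ≤ ε) :
    ∃ E : Finset X, IsSeparatedSetOf f n (2 * ε) Z E ∧ IsSpanningSetOf f n (2 * ε) Z E := by
  classical
  let S : Set ℕ := {k | ∃ E : Finset X, IsSeparatedSetOf f n (2 * ε) Z E ∧ E.card = k}
  have hne : S.Nonempty := ⟨0, ∅, ⟨by simp, by simp⟩, rfl⟩
  have hbdd : BddAbove S := by
    refine ⟨F.card, ?_⟩
    rintro k ⟨E, hE, rfl⟩
    obtain ⟨g, hgF, hg, -⟩ := hE.exists_injOn hF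
    exact Finset.card_le_card_of_injOn g hgF hg
  obtain ⟨E, hE, hcard⟩ := Nat.sSup_mem hne hbdd
  refine ⟨E, hE, fun y hy => ?_⟩
  by_cases hyE : y ∈ E
  · exact ⟨y, hyE, fun i _ => by simpa using hε⟩
  by_contra! hfar
  have hins : IsSeparatedSetOf f n (2 * ε) Z (insert y E) := by
    refine ⟨?_, fun a ha b hb hab => ?_⟩
    · rw [Finset.coe_insert]
      exact insert_subset hy hE.1
    · rcases Finset.mem_insert.1 ha with rfl | ha' <;>
        rcases Finset.mem_insert.1 hb with rfl | hb'
      · exact absurd rfl hab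
      · obtain ⟨i, hi, h⟩ := hfar b hb'
        exact ⟨i, hi, by rwa [dist_comm]⟩
      · exact hfar a ha'
      · exact hE.2 a ha' b hb' hab
  have hle : (insert y E).card ≤ sSup S := le_csSup hbdd ⟨_, hins, rfl⟩
  rw [Finset.card_insert_of_notMem hyE, hcard] at hle
  omega

lemma IsSeparatedSetOf.sum_exp_le (hE : IsSeparatedSetOf f n (2 * ε) Z E)
    (hF : IsSpanningSetOf f n ε Z F) {u : X → ℝ} {K : ℝ}
    (hu : ∀ x y, (∀ i < n, dist (f^[i] x) (f^[i] y) ≤ ε) → u y ≤ u x + K) :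
    ∑ y ∈ E, ENNReal.ofReal (Real.exp (u y)) ≤
      ENNReal.ofReal (Real.exp K) * ∑ x ∈ F, ENNReal.ofReal (Real.exp (u x)) := by
  classical
  obtain ⟨g, hgF, hg, hclose⟩ := hE.exists_injOn hF
  calc ∑ y ∈ E, ENNReal.ofReal (Real.exp (u y))
      ≤ ∑ y ∈ E, ENNReal.ofReal (Real.exp K) * ENNReal.ofReal (Real.exp (u (g y))) := by
        refine Finset.sum_le_sum fun y hy => ?_
        rw [ENNReal.ofReal_exp_mul, add_comm]
        exact ENNReal.ofReal_le_ofReal (Real.exp_le_exp.2 (hu _ _ (hclose y hy)))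
    _ = ENNReal.ofReal (Real.exp K) * ∑ x ∈ E.image g, ENNReal.ofReal (Real.exp (u x)) := by
        rw [Finset.sum_image hg, Finset.mul_sum]
    _ ≤ _ := by
        gcongr
        exact Finset.image_subset_iff.2 hgF

lemma IsSeparatedSetOf.sum_exp_linearCombination_le {F₁ F₂ : Finset X}
    (hE : IsSeparatedSetOf f n (2 * ε) Z E)
    (hF₁ : IsSpanningSetOf f n ε Z F₁) (hF₂ : IsSpanningSetOf f n ε Z F₂) {u v : X → ℝ} {K : ℝ}
    (hu : ∀ x y, (∀ i < n, dist (f^[i] x) (f^[i] y) ≤ ε) → u y ≤ u x + K)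
    (hv : ∀ x y, (∀ i < n, dist (f^[i] x) (f^[i] y) ≤ ε) → v y ≤ v x + K)
    {p q : ℝ} (hp : 0 ≤ p) (hq : 0 ≤ q) (hpq : p + q = 1) :
    ∑ y ∈ E, ENNReal.ofReal (Real.exp (p * u y + q * v y)) ≤
      ENNReal.ofReal (Real.exp K) *
        ((∑ x ∈ F₁, ENNReal.ofReal (Real.exp (u x))) ^ p *
          (∑ x ∈ F₂, ENNReal.ofReal (Real.exp (v x))) ^ q) := by
  calc ∑ y ∈ E, ENNReal.ofReal (Real.exp (p * u y + q * v y))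
      = ∑ y ∈ E, ENNReal.ofReal (Real.exp (u y)) ^ p * ENNReal.ofReal (Real.exp (v y)) ^ q := by
        simp only [ENNReal.ofReal_exp_rpow, ENNReal.ofReal_exp_mul]
    _ ≤ (∑ y ∈ E, ENNReal.ofReal (Real.exp (u y))) ^ p *
          (∑ y ∈ E, ENNReal.ofReal (Real.exp (v y))) ^ q :=
        ENNReal.sum_rpow_mul_rpow_le E _ _ hp hq hpq
    _ ≤ (ENNReal.ofReal (Real.exp K) * ∑ x ∈ F₁, ENNReal.ofReal (Real.exp (u x))) ^ p *
          (ENNReal.ofReal (Real.exp K) * ∑ x ∈ F₂, ENNReal.ofReal (Real.exp (v x))) ^ q :=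
        mul_le_mul' (ENNReal.rpow_le_rpow (hE.sum_exp_le hF₁ hu) hp)
          (ENNReal.rpow_le_rpow (hE.sum_exp_le hF₂ hv) hq)
    _ = _ := by
        rw [ENNReal.mul_rpow_of_nonneg _ _ hp, ENNReal.mul_rpow_of_nonneg _ _ hq,
          mul_mul_mul_comm, ENNReal.ofReal_exp_rpow, ENNReal.ofReal_exp_rpow,
          ENNReal.ofReal_exp_mul, ← add_mul, hpq, one_mul]

end Separated

section Pressure
variable [MetricSpace X] {f : X → X} {ψ φ : X → ℝ}

lemma eventually_inducedQ_lt {a : ℝ} (h : inducedPressure f ψ φ < a) :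
    ∀ᶠ ε in 𝓝[>] (0 : ℝ), ∀ᶠ T in atTop,
      inducedQ f ψ φ T ε < ENNReal.ofReal (Real.exp (a * T)) := by
  filter_upwards [eventually_lt_of_limsup_lt h] with ε hε
  filter_upwards [eventually_lt_of_limsup_lt hε, eventually_gt_atTop 0] with T hT hT0
  by_contra! hle
  refine hT.not_ge ?_
  have hlog := ENNReal.log_le_log hle
  rw [ENNReal.log_ofReal_exp] at hlog
  rw [← EReal.coe_mul_mul_inv_cancel a hT0]
  exact mul_le_mul_of_nonneg_right hlog (EReal.coe_nonneg.2 (inv_nonneg.2 hT0.le))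

lemma inducedPressure_le {a : ℝ}
    (h : ∀ᶠ ε in 𝓝[>] (0 : ℝ), ∀ᶠ T in atTop,
      inducedQ f ψ φ T ε ≤ ENNReal.ofReal (Real.exp (a * T))) :
    inducedPressure f ψ φ ≤ a := by
  refine limsup_le_of_le (h := ?_)
  filter_upwards [h] with ε hε
  refine limsup_le_of_le (h := ?_)
  filter_upwards [hε, eventually_gt_atTop 0] with T hT hT0
  have hlog := ENNReal.log_le_log hT
  rw [ENNReal.log_ofReal_exp] at hlog
  rw [← EReal.coe_mul_mul_inv_cancel a hT0]
  exact mul_le_mul_of_nonneg_right hlog (EReal.coe_nonneg.2 (inv_nonneg.2 hT0.le))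

lemma inducedQ_linearCombination_le {φ₁ φ₂ : X → ℝ} {c ε η T : ℝ}
    (hψ : ∀ x, c ≤ ψ x) (hε : 0 ≤ ε) (hη : 0 ≤ η)
    (h₁ : ∀ x y, dist x y ≤ ε → φ₁ y ≤ φ₁ x + η * c)
    (h₂ : ∀ x y, dist x y ≤ ε → φ₂ y ≤ φ₂ x + η * c)
    {p q : ℝ} (hp : 0 ≤ p) (hq : 0 ≤ q) (hpq : p + q = 1) {A B : ℝ≥0∞}
    (hA : inducedQ f ψ φ₁ T ε < A) (hB : inducedQ f ψ φ₂ T ε < B) :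
    inducedQ f ψ (fun x => p * φ₁ x + q * φ₂ x) T (2 * ε) ≤
      ENNReal.ofReal (Real.exp (η * T)) * (A ^ p * B ^ q) := by
  obtain ⟨F₁, hA⟩ := iInf_lt_iff.1 hA
  obtain ⟨hF₁, hA⟩ := iInf_lt_iff.1 hA
  obtain ⟨F₂, hB⟩ := iInf_lt_iff.1 hB
  obtain ⟨hF₂, hB⟩ := iInf_lt_iff.1 hB
  have hE : ∀ n : ℕ, ∃ E : Finset X, n ∈ inducedST f ψ T →
      IsSeparatedSetOf f n (2 * ε) (inducedXn f ψ T n) E ∧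
        IsSpanningSetOf f n (2 * ε) (inducedXn f ψ T n) E := by
    intro n
    by_cases hn : n ∈ inducedST f ψ T
    · obtain ⟨E, hE⟩ := (hF₁ n hn).exists_isSeparatedSetOf hε
      exact ⟨E, fun _ => hE⟩
    · exact ⟨∅, fun h => absurd h hn⟩
  choose E hE using hE
  have hn : ∀ n ∈ inducedST f ψ T, n * (η * c) ≤ η * T := by
    rintro n ⟨x, hx, -⟩
    have := mul_le_mul_of_nonneg_left ((mul_le_birkhoff f hψ n x).trans hx) hη
    linarith
  have hvar : ∀ φ : X → ℝ, (∀ x y, dist x y ≤ ε → φ y ≤ φ x + η * c) →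
      ∀ n ∈ inducedST f ψ T, ∀ x y, (∀ i < n, dist (f^[i] x) (f^[i] y) ≤ ε) →
        birkhoff f φ n y ≤ birkhoff f φ n x + η * T := fun φ hφ n hnT x y hxy =>
    (birkhoff_le_add_of_dist_le f hφ hxy).trans (by linarith [hn n hnT])
  calc inducedQ f ψ (fun x => p * φ₁ x + q * φ₂ x) T (2 * ε)
      ≤ ∑' n : inducedST f ψ T, ∑ x ∈ E n,
          ENNReal.ofReal (Real.exp (birkhoff f (fun x => p * φ₁ x + q * φ₂ x) n x)) :=
        iInf₂_le E fun n hn => (hE n hn).2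
    _ ≤ ∑' n : inducedST f ψ T, ENNReal.ofReal (Real.exp (η * T)) *
          ((∑ x ∈ F₁ n, ENNReal.ofReal (Real.exp (birkhoff f φ₁ n x))) ^ p *
            (∑ x ∈ F₂ n, ENNReal.ofReal (Real.exp (birkhoff f φ₂ n x))) ^ q) := by
        refine ENNReal.tsum_le_tsum fun n => ?_
        simp only [birkhoff_linearCombination]
        exact (hE n n.2).1.sum_exp_linearCombination_le (hF₁ n n.2) (hF₂ n n.2)
          (hvar φ₁ h₁ n n.2) (hvar φ₂ h₂ n n.2) hp hq hpq
    _ ≤ ENNReal.ofReal (Real.exp (η * T)) *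
          ((∑' n : inducedST f ψ T,
              ∑ x ∈ F₁ n, ENNReal.ofReal (Real.exp (birkhoff f φ₁ n x))) ^ p *
            (∑' n : inducedST f ψ T,
              ∑ x ∈ F₂ n, ENNReal.ofReal (Real.exp (birkhoff f φ₂ n x))) ^ q) := by
        rw [ENNReal.tsum_mul_left]
        exact mul_le_mul' le_rfl (ENNReal.tsum_rpow_mul_rpow_le _ _ hp hq hpq)
    _ ≤ _ := by gcongr

variable [CompactSpace X]

lemma Continuous.eventually_le_add_of_dist_le {φ : X → ℝ} (hφ : Continuous φ) {δ : ℝ}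
    (hδ : 0 < δ) : ∀ᶠ ε in 𝓝[>] (0 : ℝ), ∀ x y, dist x y ≤ ε → φ y ≤ φ x + δ := by
  obtain ⟨r, hr, h⟩ := Metric.uniformContinuous_iff.1
    (CompactSpace.uniformContinuous_of_continuous hφ) δ hδ
  filter_upwards [Ioo_mem_nhdsGT hr] with ε hε x y hxy
  have := h (hxy.trans_lt hε.2)
  rw [Real.dist_eq] at this
  linarith [neg_abs_le (φ x - φ y)]

lemma Continuous.exists_pos_forall_le (hψ : Continuous ψ) (hpos : ∀ x, 0 < ψ x) :
    ∃ c > 0, ∀ x, c ≤ ψ x := by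
  obtain ⟨c, hc, h⟩ := isCompact_univ.exists_forall_le' hψ.continuousOn (a := 0)
    fun x _ => hpos x
  exact ⟨c, hc, fun x => h x (mem_univ x)⟩

lemma inducedPressure_linearCombination_le {φ₁ φ₂ : X → ℝ} (hφ₁ : Continuous φ₁)
    (hφ₂ : Continuous φ₂) (hψ : Continuous ψ) (hψpos : ∀ x, 0 < ψ x) {p q : ℝ} (hp : 0 ≤ p)
    (hq : 0 ≤ q) (hpq : p + q = 1) {a b : ℝ} (ha : inducedPressure f ψ φ₁ ≤ a)
    (hb : inducedPressure f ψ φ₂ ≤ b) :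
    inducedPressure f ψ (fun x => p * φ₁ x + q * φ₂ x) ≤ ((p * a + q * b : ℝ) : EReal) := by
  obtain ⟨c, hc, hcψ⟩ := hψ.exists_pos_forall_le hψpos
  suffices h : ∀ η : ℝ, 0 < η → inducedPressure f ψ (fun x => p * φ₁ x + q * φ₂ x) ≤
      ((p * a + q * b + 2 * η : ℝ) : EReal) by
    refine EReal.le_of_forall_lt_iff_le.1 fun z hz => ?_
    have hz := EReal.coe_lt_coe_iff.1 hz
    convert h ((z - (p * a + q * b)) / 2) (by linarith) using 2
    ring
  intro η hη
  have ha' : inducedPressure f ψ φ₁ < ((a + η : ℝ) : EReal) :=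
    ha.trans_lt (EReal.coe_lt_coe_iff.2 (by linarith))
  have hb' : inducedPressure f ψ φ₂ < ((b + η : ℝ) : EReal) :=
    hb.trans_lt (EReal.coe_lt_coe_iff.2 (by linarith))
  have key : ∀ᶠ ε in 𝓝[>] (0 : ℝ), ∀ᶠ T in atTop,
      inducedQ f ψ (fun x => p * φ₁ x + q * φ₂ x) T (2 * ε) ≤
        ENNReal.ofReal (Real.exp ((p * a + q * b + 2 * η) * T)) := by
    filter_upwards [eventually_inducedQ_lt ha', eventually_inducedQ_lt hb',
      hφ₁.eventually_le_add_of_dist_le (mul_pos hη hc),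
      hφ₂.eventually_le_add_of_dist_le (mul_pos hη hc), self_mem_nhdsWithin]
      with ε h₁ h₂ hv₁ hv₂ hε
    filter_upwards [h₁, h₂] with T hT₁ hT₂
    refine (inducedQ_linearCombination_le hcψ (le_of_lt hε) hη.le hv₁ hv₂ hp hq hpq
      hT₁ hT₂).trans_eq ?_
    rw [ENNReal.ofReal_exp_rpow, ENNReal.ofReal_exp_rpow, ENNReal.ofReal_exp_mul,
      ENNReal.ofReal_exp_mul]
    congr 2
    linear_combination η * T * hpq
  have hhalf : Tendsto (fun ε : ℝ => ε / 2) (𝓝[>] 0) (𝓝[>] 0) := by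
    refine tendsto_nhdsWithin_iff.2 ⟨?_, ?_⟩
    · have : Tendsto (fun ε : ℝ => ε / 2) (𝓝 0) (𝓝 (0 / 2)) := tendsto_id.div_const 2
      rw [zero_div] at this
      exact this.mono_left nhdsWithin_le_nhds
    · filter_upwards [self_mem_nhdsWithin] with ε hε
      exact half_pos (mem_Ioi.1 hε)
  refine inducedPressure_le ?_
  filter_upwards [hhalf.eventually key] with ε hε
  simpa only [mul_div_cancel₀ ε (two_ne_zero' ℝ)] using hε

end Pressure

section Tangent
variable [MetricSpace X] [MeasurableSpace X] {f : X → X}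
  {ψ φ : X → ℝ} {m : ProbabilityMeasure X}

lemma exists_coe_eq_inducedPressure (hm : m ∈ tangentSet f ψ φ) :
    ∃ r : ℝ, inducedPressure f ψ φ = r := by
  have h := hm (fun _ => 0) continuous_const
  simp only [integral_zero, zero_div, add_zero, EReal.coe_zero] at h
  induction hP : inducedPressure f ψ φ with
  | bot => simp [hP] at h
  | top => simp [hP] at h
  | coe r => exact ⟨r, rfl⟩

lemma coe_add_le_inducedPressure (hm : m ∈ tangentSet f ψ φ) {r : ℝ}
    (hr : inducedPressure f ψ φ = r) {g φ' : X → ℝ} (hg : Continuous g)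
    (hφ' : ∀ x, φ' x = φ x + g x) :
    ((r + (∫ x, g x ∂(m : Measure X)) / (∫ x, ψ x ∂(m : Measure X)) : ℝ) : EReal) ≤
      inducedPressure f ψ φ' := by
  have h := hm g hg
  rw [hr] at h
  rw [funext hφ', EReal.coe_add, add_comm]
  exact EReal.add_le_of_le_sub h

lemma mem_tangentSet_of_linearCombination [CompactSpace X] {φ₁ φ₂ : X → ℝ}
    (hφ₁ : Continuous φ₁) (hφ₂ : Continuous φ₂) (hψ : Continuous ψ) (hψpos : ∀ x, 0 < ψ x)
    {p q : ℝ} (hp : 0 < p) (hq : 0 ≤ q) (hpq : p + q = 1) {a b : ℝ}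
    (ha : inducedPressure f ψ φ₁ = a) (hb : inducedPressure f ψ φ₂ = b)
    (hab : inducedPressure f ψ (fun x => p * φ₁ x + q * φ₂ x) = ((p * a + q * b : ℝ) : EReal))
    (hm : m ∈ tangentSet f ψ (fun x => p * φ₁ x + q * φ₂ x)) : m ∈ tangentSet f ψ φ₁ := by
  intro g hg
  rw [ha, EReal.le_sub_iff_add_le (by simp) (by simp), ← EReal.coe_add]
  by_contra! hlt
  obtain ⟨s, hs, hs'⟩ := EReal.lt_iff_exists_real_btwn.1 hlt
  have hle := inducedPressure_linearCombination_le (f := f) (hφ₁.add hg) hφ₂ hψ hψpos hp.le hq hpq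
    hs.le hb.le
  have hge := coe_add_le_inducedPressure hm hab (g := fun x => p * g x)
    (φ' := fun x => p * (φ₁ x + g x) + q * φ₂ x) (continuous_const.mul hg) (fun x => by ring)
  have h := EReal.coe_le_coe_iff.1 (hge.trans hle)
  rw [integral_const_mul, mul_div_assoc] at h
  have h' := EReal.coe_lt_coe_iff.1 hs'
  have := mul_lt_mul_of_pos_left h' hp
  linarith

end Tangent

/-- If `t_{ψ,φ₁}(X,f) ∩ t_{ψ,φ₂}(X,f) ≠ ∅`, then for every `m` in the
intersection and every `p ∈ [0,1]`,
`P_ψ(pφ₁+(1−p)φ₂) = P_ψ(φ₁) + (1−p)(∫(φ₂−φ₁)dm)/(∫ψ dm)`; moreover for `p ∈ (0,1)`,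
`t_{ψ,pφ₁+(1−p)φ₂}(X,f) ⊆ t_{ψ,φ₁}(X,f) ∩ t_{ψ,φ₂}(X,f)`. -/
theorem tangentSet_inter
    {X : Type*} [MetricSpace X] [CompactSpace X] [Nonempty X]
    [MeasurableSpace X] [BorelSpace X]
    (f : X → X) (hf : Continuous f)
    (φ₁ φ₂ ψ : X → ℝ) (hφ₁ : Continuous φ₁) (hφ₂ : Continuous φ₂) (hψ : Continuous ψ)
    (hψpos : ∀ x, 0 < ψ x) (htop : topEntropy f < ⊤)
    (hne : (tangentSet f ψ φ₁ ∩ tangentSet f ψ φ₂).Nonempty) :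
    (∀ m ∈ tangentSet f ψ φ₁ ∩ tangentSet f ψ φ₂, ∀ p ∈ Set.Icc (0 : ℝ) 1,
        inducedPressure f ψ (fun x => p * φ₁ x + (1 - p) * φ₂ x) =
          inducedPressure f ψ φ₁ +
            ((((1 - p) * ((∫ x, (φ₂ x - φ₁ x) ∂(m : Measure X)) /
              (∫ x, ψ x ∂(m : Measure X)))) : ℝ) : EReal)) ∧
    ∀ p : ℝ, 0 < p → p < 1 →
      tangentSet f ψ (fun x => p * φ₁ x + (1 - p) * φ₂ x) ⊆
        tangentSet f ψ φ₁ ∩ tangentSet f ψ φ₂ := by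
  have key : ∀ m ∈ tangentSet f ψ φ₁ ∩ tangentSet f ψ φ₂, ∃ a b : ℝ,
      inducedPressure f ψ φ₁ = a ∧ inducedPressure f ψ φ₂ = b ∧
      b = a + (∫ x, (φ₂ x - φ₁ x) ∂(m : Measure X)) / (∫ x, ψ x ∂(m : Measure X)) ∧
      ∀ p ∈ Set.Icc (0 : ℝ) 1, inducedPressure f ψ (fun x => p * φ₁ x + (1 - p) * φ₂ x) =
        ((p * a + (1 - p) * b : ℝ) : EReal) := by
    rintro m ⟨hm₁, hm₂⟩
    obtain ⟨a, ha⟩ := exists_coe_eq_inducedPressure hm₁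
    obtain ⟨b, hb⟩ := exists_coe_eq_inducedPressure hm₂
    have h₁ := coe_add_le_inducedPressure hm₁ ha (hφ₂.sub hφ₁) (φ' := φ₂) (fun x => by simp)
    have h₂ := coe_add_le_inducedPressure hm₂ hb (hφ₂.sub hφ₁).neg (φ' := φ₁) (fun x => by simp)
    rw [hb, EReal.coe_le_coe_iff] at h₁
    rw [ha, EReal.coe_le_coe_iff] at h₂
    simp only [Pi.sub_apply, Pi.neg_apply, integral_neg, neg_div] at h₁ h₂
    have hab : b = a + (∫ x, (φ₂ x - φ₁ x) ∂(m : Measure X)) / (∫ x, ψ x ∂(m : Measure X)) := by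
      linarith
    refine ⟨a, b, ha, hb, hab, fun p hp => le_antisymm ?_ ?_⟩
    · exact inducedPressure_linearCombination_le hφ₁ hφ₂ hψ hψpos hp.1 (sub_nonneg.2 hp.2)
        (by ring) ha.le hb.le
    · refine le_trans (EReal.coe_le_coe_iff.2 ?_) (coe_add_le_inducedPressure hm₁ ha
        (continuous_const.mul (hφ₂.sub hφ₁)) (g := fun x => (1 - p) * (φ₂ x - φ₁ x))
        (φ' := fun x => p * φ₁ x + (1 - p) * φ₂ x) (fun x => by ring))
      rw [integral_const_mul, mul_div_assoc]
      refine le_of_eq ?_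
      rw [hab]
      ring
  refine ⟨fun m hm p hp => ?_, fun p hp0 hp1 m hm => ?_⟩
  · obtain ⟨a, b, ha, -, hab, h⟩ := key m hm
    rw [h p hp, ha, ← EReal.coe_add, hab]
    congr 1
    ring
  · obtain ⟨m₀, hm₀⟩ := hne
    obtain ⟨a, b, ha, hb, -, h⟩ := key m₀ hm₀
    have h := h p ⟨hp0.le, hp1.le⟩
    refine ⟨mem_tangentSet_of_linearCombination hφ₁ hφ₂ hψ hψpos hp0 (sub_nonneg.2 hp1.le)
      (by ring) ha hb h hm, ?_⟩
    have hswap : (fun x => p * φ₁ x + (1 - p) * φ₂ x) = fun x => (1 - p) * φ₂ x + p * φ₁ x :=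
      funext fun x => add_comm _ _
    rw [hswap] at h hm
    rw [add_comm] at h
    exact mem_tangentSet_of_linearCombination hφ₂ hφ₁ hψ hψpos (sub_pos.2 hp1) hp0.le
      (by ring) hb ha h hm
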